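/- Let F, F' be nonempty subsets of [r] and let P = Δ_F + Δ_{F'}. Then the number of edges of P equals (1/2)·[ |F∖F'|·|F'∖F|·(|F| + |F'| − 2) + |F∩F'|·(|F∪F'| − 1)·(|F∖F'| + |F'∖F| + 1) ]. -/

import Mathlib

open Pointwise

/-- The standard basis vector `e i` in `ℝ^r`. -/
noncomputable def eVec (r : ℕ) (i : Fin r) : Fin r → ℝ := Pi.single i 1

/-- The standard simplex `Δ_F ⊆ ℝ^r` supported on a subset `F` of the coordinates. -/
def simpl {r : ℕ} (F : Finset (Fin r)) : Set (Fin r → ℝ) :=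
  {x | (∀ i, 0 ≤ x i) ∧ (∀ i, i ∉ F → x i = 0) ∧ ∑ i, x i = 1}

/-- The Minkowski sum `P_𝓕 = Δ_{F 0} + ⋯ + Δ_{F (k-1)}`. -/
noncomputable def mink {r k : ℕ} (F : Fin k → Finset (Fin r)) : Set (Fin r → ℝ) :=
  ∑ j : Fin k, simpl (F j)

/-- `[u,v]` is an edge of `P`: `u ≠ v` are vertices (extreme points) of `P` and the
segment `[u,v]` is an extreme subset (face) of `P`. -/
def IsEdgeOf {r : ℕ} (P : Set (Fin r → ℝ)) (u v : Fin r → ℝ) : Prop :=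
  u ≠ v ∧ u ∈ Set.extremePoints ℝ P ∧ v ∈ Set.extremePoints ℝ P ∧
    IsExtreme ℝ P (segment ℝ u v)

/-- The degree of a vertex `u` of `P`: the number of `v` with `[u,v]` an edge of `P`. -/
noncomputable def polyDeg {r : ℕ} (P : Set (Fin r → ℝ)) (u : Fin r → ℝ) : ℕ :=
  {v | IsEdgeOf P u v}.ncard

/-- The number of edges of `P`, counted as segments. -/
noncomputable def numEdgesOf {r : ℕ} (P : Set (Fin r → ℝ)) : ℕ :=
  {s : Set (Fin r → ℝ) | ∃ u v, IsEdgeOf P u v ∧ s = segment ℝ u v}.ncard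

/-- The point `u(f) = e_{f 0} + ⋯ + e_{f (k-1)}` associated to a rep-function `f`. -/
noncomputable def urep {r k : ℕ} (f : Fin k → Fin r) : Fin r → ℝ :=
  ∑ j, eVec r (f j)

section Helpers

variable {r : ℕ}

lemma eVec_mem_simpl {F : Finset (Fin r)} {i : Fin r} (hi : i ∈ F) : eVec r i ∈ simpl F := by
  refine ⟨fun j => ?_, fun j hj => ?_, ?_⟩
  · by_cases h : j = i
    · subst h; simp [eVec]
    · simp [eVec, h]
  · have : j ≠ i := fun h => hj (h ▸ hi)
    simp [eVec, this]
  · simp [eVec]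

lemma simpl_mono {A F : Finset (Fin r)} (h : A ⊆ F) : simpl A ⊆ simpl F :=
  fun _ hx => ⟨hx.1, fun i hi => hx.2.1 i (fun h' => hi (h h')), hx.2.2⟩

lemma convex_simpl (F : Finset (Fin r)) : Convex ℝ (simpl F) := by
  intro x hx y hy a b ha hb hab
  refine ⟨fun i => ?_, fun i hi => ?_, ?_⟩
  · have := hx.1 i
    have := hy.1 i
    simp only [Pi.add_apply, Pi.smul_apply, smul_eq_mul]
    positivity
  · simp [hx.2.1 i hi, hy.2.1 i hi]
  · simp only [Pi.add_apply, Pi.smul_apply, smul_eq_mul, Finset.sum_add_distrib,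
      ← Finset.mul_sum, hx.2.2, hy.2.2]
    linarith

lemma simpl_eq_sum {F : Finset (Fin r)} {x : Fin r → ℝ} (hx : x ∈ simpl F) :
    x = ∑ i ∈ F, x i • eVec r i := by
  funext j
  simp only [Finset.sum_apply, Pi.smul_apply, eVec, Pi.single_apply, smul_eq_mul, mul_ite,
    mul_one, mul_zero, Finset.sum_ite_eq]
  split_ifs with h
  · rfl
  · exact hx.2.1 j h

lemma simpl_sum {F : Finset (Fin r)} {x : Fin r → ℝ} (hx : x ∈ simpl F) :
    ∑ i ∈ F, x i = 1 := by
  rw [← hx.2.2]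
  exact Finset.sum_subset (Finset.subset_univ _) (fun i _ hi => hx.2.1 i hi)

lemma simpl_eq_convexHull (F : Finset (Fin r)) :
    simpl F = convexHull ℝ (eVec r '' (F : Set (Fin r))) := by
  apply Set.Subset.antisymm
  · intro x hx
    rw [simpl_eq_sum hx]
    exact (convex_convexHull ℝ _).sum_mem (fun i _ => hx.1 i) (simpl_sum hx)
      (fun i hi => subset_convexHull ℝ _ ⟨i, hi, rfl⟩)
  · refine convexHull_min ?_ (convex_simpl F)
    rintro _ ⟨i, hi, rfl⟩
    exact eVec_mem_simpl hi

lemma extreme_form {F F' : Finset (Fin r)} {u : Fin r → ℝ}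
    (hu : u ∈ Set.extremePoints ℝ (simpl F + simpl F')) :
    ∃ i ∈ F, ∃ j ∈ F', u = eVec r i + eVec r j := by
  rw [simpl_eq_convexHull, simpl_eq_convexHull, ← convexHull_add] at hu
  obtain ⟨_, ⟨i, hi, rfl⟩, _, ⟨j, hj, rfl⟩, h⟩ := extremePoints_convexHull_subset hu
  exact ⟨i, hi, j, hj, h.symm⟩

lemma dot_le {F : Finset (Fin r)} {w : Fin r → ℝ} {m : ℝ} (hw : ∀ i ∈ F, w i ≤ m)
    {x : Fin r → ℝ} (hx : x ∈ simpl F) : ∑ i, w i * x i ≤ m := by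
  have : ∑ i, w i * x i ≤ ∑ i, m * x i := by
    apply Finset.sum_le_sum
    intro i _
    by_cases h : i ∈ F
    · exact mul_le_mul_of_nonneg_right (hw i h) (hx.1 i)
    · simp [hx.2.1 i h]
  rwa [← Finset.mul_sum, hx.2.2, mul_one] at this

lemma dot_eq {A : Finset (Fin r)} {w : Fin r → ℝ} {m : ℝ} (hw : ∀ i ∈ A, w i = m)
    {x : Fin r → ℝ} (hx : x ∈ simpl A) : ∑ i, w i * x i = m := by
  have : ∑ i, w i * x i = ∑ i, m * x i := by
    apply Finset.sum_congr rfl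
    intro i _
    by_cases h : i ∈ A
    · rw [hw i h]
    · simp [hx.2.1 i h]
  rwa [← Finset.mul_sum, hx.2.2, mul_one] at this

lemma mem_of_dot_eq {F A : Finset (Fin r)} {w : Fin r → ℝ} {m : ℝ} (hw : ∀ i ∈ F, w i ≤ m)
    (hlt : ∀ i ∈ F, i ∉ A → w i < m)
    {x : Fin r → ℝ} (hx : x ∈ simpl F) (h : m ≤ ∑ i, w i * x i) : x ∈ simpl A := by
  refine ⟨hx.1, fun i hi => ?_, hx.2.2⟩
  by_cases hiF : i ∈ F
  · by_contra hne
    have hpos : 0 < x i := lt_of_le_of_ne (hx.1 i) (Ne.symm hne)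
    have : ∑ i, w i * x i < ∑ i, m * x i := by
      apply Finset.sum_lt_sum
      · intro i _
        by_cases h : i ∈ F
        · exact mul_le_mul_of_nonneg_right (hw i h) (hx.1 i)
        · simp [hx.2.1 i h]
      · exact ⟨i, Finset.mem_univ _, mul_lt_mul_of_pos_right (hlt i hiF hi) hpos⟩
    rw [← Finset.mul_sum, hx.2.2, mul_one] at this
    linarith
  · exact hx.2.1 i hiF

lemma face_of_weight {F F' A B : Finset (Fin r)} (hA : A ⊆ F) (hB : B ⊆ F')
    (w : Fin r → ℝ) (m m' : ℝ) (hwA : ∀ i ∈ A, w i = m) (hwB : ∀ i ∈ B, w i = m')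
    (hF : ∀ i ∈ F, i ∉ A → w i < m) (hF' : ∀ i ∈ F', i ∉ B → w i < m') :
    IsExtreme ℝ (simpl F + simpl F') (simpl A + simpl B) := by
  have hF1 : ∀ i ∈ F, w i ≤ m := fun i hi => by
    by_cases h : i ∈ A
    · exact (hwA i h).le
    · exact (hF i hi h).le
  have hF1' : ∀ i ∈ F', w i ≤ m' := fun i hi => by
    by_cases h : i ∈ B
    · exact (hwB i h).le
    · exact (hF' i hi h).le
  refine ⟨Set.add_subset_add (simpl_mono hA) (simpl_mono hB), ?_⟩
  rintro _ ⟨x, hx, x', hx', rfl⟩ _ ⟨y, hy, y', hy', rfl⟩ _ ⟨z, hz, z', hz', rfl⟩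
    ⟨a, b, ha, hb, hab, h⟩
  have hz1 := dot_eq hwA hz
  have hz2 := dot_eq hwB hz'
  have hx1 := dot_le hF1 hx
  have hx2 := dot_le hF1' hx'
  have hy1 := dot_le hF1 hy
  have hy2 := dot_le hF1' hy'
  have key : a * (∑ i, w i * x i + ∑ i, w i * x' i) + b * (∑ i, w i * y i + ∑ i, w i * y' i)
      = ∑ i, w i * z i + ∑ i, w i * z' i := by
    simp only [← Finset.sum_add_distrib, Finset.mul_sum]
    apply Finset.sum_congr rfl
    intro i _
    have := congrFun h i
    simp only [Pi.add_apply, Pi.smul_apply, smul_eq_mul] at this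
    linear_combination w i * this
  have hge : m + m' ≤ ∑ i, w i * x i + ∑ i, w i * x' i := by
    by_contra hcon
    push Not at hcon
    rw [hz1, hz2] at key
    have h1 := mul_lt_mul_of_pos_left hcon ha
    have h2 := mul_le_mul_of_nonneg_left (add_le_add hy1 hy2) hb.le
    have : a * (m + m') + b * (m + m') = m + m' := by rw [← add_mul, hab, one_mul]
    linarith
  exact ⟨x, mem_of_dot_eq hF1 hF hx (by linarith), x',
    mem_of_dot_eq hF1' hF' hx' (by linarith), rfl⟩

lemma face_valid {F F' A B : Finset (Fin r)} (hA : A ⊆ F) (hB : B ⊆ F')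
    (h : (∀ i ∈ A, i ∉ F') ∨ (∀ i ∈ B, i ∉ F) ∨
      ((∀ i ∈ A, i ∈ F' → i ∈ B) ∧ (∀ i ∈ B, i ∈ F → i ∈ A))) :
    IsExtreme ℝ (simpl F + simpl F') (simpl A + simpl B) := by
  rcases h with h | h | ⟨h1, h2⟩
  · refine face_of_weight hA hB (fun i => if i ∈ A then 2 else if i ∈ B then 1 else 0) 2 1
      ?_ ?_ ?_ ?_
    · intro i hi; simp [hi]
    · intro i hi
      have : i ∉ A := fun h' => h i h' (hB hi)
      simp [hi, this]
    · intro i _ hi; simp only [hi, if_false]; split_ifs <;> norm_num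
    · intro i hi hi'
      have : i ∉ A := fun h' => h i h' hi
      simp [hi', this]
  · refine face_of_weight hA hB (fun i => if i ∈ B then 2 else if i ∈ A then 1 else 0) 1 2
      ?_ ?_ ?_ ?_
    · intro i hi
      have : i ∉ B := fun h' => h i h' (hA hi)
      simp [hi, this]
    · intro i hi; simp [hi]
    · intro i hi hi'
      have : i ∉ B := fun h' => h i h' hi
      simp [hi', this]
    · intro i _ hi; simp only [hi, if_false]; split_ifs <;> norm_num
  · refine face_of_weight hA hB (fun i => if i ∈ A ∨ i ∈ B then 1 else 0) 1 1 ?_ ?_ ?_ ?_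
    · intro i hi; simp [hi]
    · intro i hi; simp [hi]
    · intro i hi hi'
      have : i ∉ B := fun h' => hi' (h2 i h' hi)
      simp [hi', this]
    · intro i hi hi'
      have : i ∉ A := fun h' => hi' (h1 i h' hi)
      simp [hi', this]

lemma simpl_single (i : Fin r) : simpl {i} = {eVec r i} := by
  simp [simpl_eq_convexHull]

lemma simpl_pair (i j : Fin r) : simpl {i, j} = segment ℝ (eVec r i) (eVec r j) := by
  simp [simpl_eq_convexHull, Set.image_pair, convexHull_pair]

lemma single_add_segment (a u v : Fin r → ℝ) :
    {a} + segment ℝ u v = segment ℝ (a + u) (a + v) := by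
  rw [Set.singleton_add, segment_translate_image]

lemma segment_add_self (u v : Fin r → ℝ) :
    segment ℝ u v + segment ℝ u v = segment ℝ (u + u) (v + v) := by
  ext x
  constructor
  · rintro ⟨_, ⟨a, b, ha, hb, hab, rfl⟩, _, ⟨c, d, hc, hd, hcd, rfl⟩, rfl⟩
    refine ⟨(a + c) / 2, (b + d) / 2, by positivity, by positivity, by linarith, ?_⟩
    ext i
    simp
    ring
  · rintro ⟨a, b, ha, hb, hab, rfl⟩
    refine ⟨a • u + b • v, ⟨a, b, ha, hb, hab, rfl⟩, a • u + b • v, ⟨a, b, ha, hb, hab, rfl⟩, ?_⟩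
    ext i
    simp
    ring

/-- combinatorial vertices -/
def IsV (F F' : Finset (Fin r)) (i j : Fin r) : Prop :=
  i ∈ F ∧ j ∈ F' ∧ (i = j ∨ i ∉ F' ∨ j ∉ F)

lemma extreme_iff {F F' : Finset (Fin r)} {i j : Fin r} (hi : i ∈ F) (hj : j ∈ F') :
    eVec r i + eVec r j ∈ Set.extremePoints ℝ (simpl F + simpl F') ↔ IsV F F' i j := by
  constructor
  · intro h
    refine ⟨hi, hj, ?_⟩
    by_contra! hcon
    obtain ⟨hne, hi', hj'⟩ := hcon
    have := h.2 (Set.add_mem_add (eVec_mem_simpl hi) (eVec_mem_simpl hi'))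
      (Set.add_mem_add (eVec_mem_simpl hj') (eVec_mem_simpl hj))
      ⟨1/2, 1/2, by norm_num, by norm_num, by norm_num, by ext x; simp; ring⟩
    have h2 := congrFun this i
    simp [eVec, hne] at h2
  · rintro ⟨-, -, h⟩
    have := face_valid (F := F) (F' := F') (A := {i}) (B := {j}) (by simpa) (by simpa) (by
      simp only [Finset.mem_singleton, forall_eq]
      rcases h with h | h | h
      · subst h; simp
      · exact Or.inl h
      · exact Or.inr (Or.inl h))
    rw [simpl_single, simpl_single, Set.singleton_add_singleton] at this
    exact isExtreme_singleton.1 this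

/-- combinatorial adjacency -/
def Adj4 (i j k l : Fin r) : Prop :=
  (i = k ∧ j ≠ l) ∨ (j = l ∧ i ≠ k) ∨ (i = j ∧ k = l ∧ i ≠ k)

lemma vert_inj {F F' : Finset (Fin r)} {i j k l : Fin r} (h : IsV F F' i j) (h' : IsV F F' k l)
    (he : eVec r i + eVec r j = eVec r k + eVec r l) : i = k ∧ j = l := by
  have key : ∀ x, ((if x = i then 1 else 0) + (if x = j then 1 else 0) : ℝ) =
      (if x = k then 1 else 0) + (if x = l then 1 else 0) := fun x => by
    have := congrFun he x
    simpa only [eVec, Pi.add_apply, Pi.single_apply] using this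
  have : (i = k ∧ j = l) ∨ (i = l ∧ j = k) := by
    have inj : ∀ x y : Fin r, eVec r x = eVec r y → x = y := fun x y hxy => by
      have := congrFun hxy x
      by_contra hne
      simp [eVec, hne] at this
    by_cases a : i = k
    · subst a
      exact Or.inl ⟨rfl, inj _ _ (add_left_cancel he)⟩
    · have h1 := key i
      by_cases b : i = l
      · subst b
        rw [add_comm (eVec r k)] at he
        exact Or.inr ⟨rfl, inj _ _ (add_left_cancel he)⟩
      · rw [if_pos rfl, if_neg a, if_neg b] at h1
        split_ifs at h1 <;> norm_num at h1
  rcases this with h1 | ⟨rfl, rfl⟩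
  · exact h1
  · obtain ⟨a, b, c⟩ := h
    obtain ⟨a', b', c'⟩ := h'
    rcases c with c | c | c
    · exact ⟨c, c.symm⟩
    · exact absurd b' c
    · exact absurd a' c

lemma adj_of_edge {i j k l : Fin r} (hik : i ≠ k) (hjl : j ≠ l)
    (h : eVec r i + eVec r l ∈ segment ℝ (eVec r i + eVec r j) (eVec r k + eVec r l)) :
    i = j ∧ k = l := by
  obtain ⟨a, b, ha, hb, hab, he⟩ := h
  have key : ∀ x, a * ((if x = i then 1 else 0) + (if x = j then 1 else 0)) +
      b * ((if x = k then 1 else 0) + (if x = l then 1 else 0)) =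
      ((if x = i then 1 else 0) + (if x = l then 1 else 0) : ℝ) := fun x => by
    have := congrFun he x
    simpa only [eVec, Pi.add_apply, Pi.single_apply, Pi.smul_apply, smul_eq_mul] using this
  have h1 := key i
  have h2 := key j
  have h3 := key k
  have h4 := key l
  have hik' := hik.symm
  have hjl' := hjl.symm
  by_cases A : i = j
  · subst A
    refine ⟨rfl, ?_⟩
    by_contra B
    have B' : ¬ l = k := fun h => B h.symm
    simp [*] at h1 h2 h3 h4
    subst h3
    linarith
  · exfalso
    have A' : ¬ j = i := fun h => A h.symm
    by_cases C : j = k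
    · subst C
      by_cases D : i = l
      · subst D
        simp [*] at h1 h2 h3 h4
        try linarith
      · have D' : ¬ l = i := fun h => D h.symm
        simp [*] at h1 h2 h3 h4
        try linarith
    · have C' : ¬ k = j := fun h => C h.symm
      simp [*] at h2
      subst h2
      have : b = 1 := by linarith
      subst this
      by_cases D : i = l
      · subst D
        simp [*] at h3
      · have D' : ¬ l = i := fun h => D h.symm
        simp [*] at h1

lemma edge_iff {F F' : Finset (Fin r)} {i j k l : Fin r} (h : IsV F F' i j) (h' : IsV F F' k l) :
    IsEdgeOf (simpl F + simpl F') (eVec r i + eVec r j) (eVec r k + eVec r l) ↔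
      Adj4 i j k l := by
  constructor
  · rintro ⟨hne, -, -, hE⟩
    by_cases hik : i = k
    · subst hik
      exact Or.inl ⟨rfl, fun h => hne (by rw [h])⟩
    by_cases hjl : j = l
    · exact Or.inr (Or.inl ⟨hjl, hik⟩)
    have hm := hE.left_mem_of_mem_openSegment
      (Set.add_mem_add (eVec_mem_simpl h.1) (eVec_mem_simpl h'.2.1))
      (Set.add_mem_add (eVec_mem_simpl h'.1) (eVec_mem_simpl h.2.1))
      (z := (1/2 : ℝ) • (eVec r i + eVec r j) + (1/2 : ℝ) • (eVec r k + eVec r l))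
      ⟨1/2, 1/2, by norm_num, by norm_num, by norm_num, rfl⟩
      ⟨1/2, 1/2, by norm_num, by norm_num, by norm_num, by ext x; simp; ring⟩
    obtain ⟨e1, e2⟩ := adj_of_edge hik hjl hm
    exact Or.inr (Or.inr ⟨e1, e2, hik⟩)
  · intro hA
    refine ⟨?_, (extreme_iff h.1 h.2.1).2 h, (extreme_iff h'.1 h'.2.1).2 h', ?_⟩
    · intro he
      obtain ⟨rfl, rfl⟩ := vert_inj h h' he
      simp [Adj4] at hA
    · obtain ⟨hi, hj, hv⟩ := h
      obtain ⟨hk, hl, hv'⟩ := h'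
      rcases hA with ⟨rfl, hne⟩ | ⟨rfl, hne⟩ | ⟨rfl, rfl, hne⟩
      · rw [← single_add_segment, ← simpl_pair, ← simpl_single]
        apply face_valid
        · simpa
        · simp [Finset.insert_subset_iff, *]
        · simp only [Finset.mem_singleton, Finset.mem_insert, forall_eq, forall_eq_or_imp]
          grind
      · rw [add_comm (eVec r i), add_comm (eVec r k), ← single_add_segment, ← simpl_pair,
          ← simpl_single, add_comm (simpl {j})]
        apply face_valid
        · simp [Finset.insert_subset_iff, *]
        · simpa
        · simp only [Finset.mem_singleton, Finset.mem_insert, forall_eq, forall_eq_or_imp]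
          grind
      · rw [← segment_add_self, ← simpl_pair]
        apply face_valid
        · simp [Finset.insert_subset_iff, *]
        · simp [Finset.insert_subset_iff, *]
        · right; right; exact ⟨fun _ h _ => h, fun _ h _ => h⟩

open Classical in
/-- ordered pairs of vertices in the same row -/
noncomputable def rowPairs (F F' : Finset (Fin r)) :
    Finset ((Fin r × Fin r) × (Fin r × Fin r)) :=
  Finset.univ.filter fun p => IsV F F' p.1.1 p.1.2 ∧ IsV F F' p.2.1 p.2.2 ∧
    p.1.1 = p.2.1 ∧ p.1.2 ≠ p.2.2

open Classical in
/-- ordered pairs of adjacent vertices -/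
noncomputable def adjPairs (F F' : Finset (Fin r)) :
    Finset ((Fin r × Fin r) × (Fin r × Fin r)) :=
  Finset.univ.filter fun p => IsV F F' p.1.1 p.1.2 ∧ IsV F F' p.2.1 p.2.2 ∧
    Adj4 p.1.1 p.1.2 p.2.1 p.2.2

open Classical in
lemma card_rowPairs (F F' : Finset (Fin r)) :
    (rowPairs F F').card =
      (F \ F').card * (F'.card * F'.card - F'.card) +
      (F ∩ F').card * (((F' \ F).card + 1) * (F' \ F).card) := by
  have h1 : (rowPairs F F').card =
      (F.sigma fun i => (F'.filter fun j => IsV F F' i j).offDiag).card := by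
    refine Finset.card_bij' (fun p _ => ⟨p.1.1, (p.1.2, p.2.2)⟩)
      (fun s _ => ((s.1, s.2.1), (s.1, s.2.2))) ?_ ?_ ?_ ?_
    · rintro ⟨⟨i, j⟩, k, l⟩ h
      simp only [rowPairs, Finset.mem_filter, Finset.mem_univ, true_and] at h
      obtain ⟨h1, h2, rfl, h4⟩ := h
      simp only [Finset.mem_sigma, Finset.mem_offDiag, Finset.mem_filter]
      exact ⟨h1.1, ⟨h1.2.1, h1⟩, ⟨h2.2.1, h2⟩, h4⟩
    · rintro ⟨i, j, l⟩ h
      simp only [Finset.mem_sigma, Finset.mem_offDiag, Finset.mem_filter] at h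
      simp only [rowPairs, Finset.mem_filter, Finset.mem_univ, true_and]
      exact ⟨h.2.1.2, h.2.2.1.2, h.2.2.2⟩
    · rintro ⟨⟨i, j⟩, k, l⟩ h
      simp only [rowPairs, Finset.mem_filter, Finset.mem_univ, true_and] at h
      obtain ⟨h1, h2, rfl, h4⟩ := h
      rfl
    · rintro ⟨i, j, l⟩ h
      rfl
  rw [h1, Finset.card_sigma, ← Finset.sum_sdiff (Finset.sdiff_subset : F \ F' ⊆ F),
    (by ext x; simp : F \ (F \ F') = F ∩ F'), add_comm]
  congr 1
  · rw [Finset.sum_const_nat]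
    intro i hi
    rw [Finset.mem_sdiff] at hi
    rw [Finset.filter_true_of_mem, Finset.offDiag_card]
    intro j hj
    exact ⟨hi.1, hj, Or.inr (Or.inl hi.2)⟩
  · rw [Finset.sum_const_nat]
    intro i hi
    rw [Finset.mem_inter] at hi
    have : (F'.filter fun j => IsV F F' i j) = insert i (F' \ F) := by
      ext j
      simp only [Finset.mem_filter, Finset.mem_insert, Finset.mem_sdiff, IsV]
      grind
    rw [this, Finset.offDiag_card, Finset.card_insert_of_notMem (by simp [hi.1]),
      ← Nat.mul_sub_one, Nat.add_sub_cancel]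

open Classical in
lemma card_adjPairs (F F' : Finset (Fin r)) :
    (adjPairs F F').card = (rowPairs F F').card + (rowPairs F' F).card +
      ((F ∩ F').card * (F ∩ F').card - (F ∩ F').card) := by
  have h2 : (rowPairs F' F).card = ((rowPairs F' F).image
      fun p => (p.1.swap, p.2.swap)).card := by
    rw [Finset.card_image_of_injective]
    rintro ⟨⟨i, j⟩, k, l⟩ ⟨⟨i', j'⟩, k', l'⟩ h
    simp at h
    grind
  have h3 : ((F ∩ F').card * (F ∩ F').card - (F ∩ F').card) = ((F ∩ F').offDiag.image
      fun p => ((p.1, p.1), (p.2, p.2))).card := by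
    rw [Finset.card_image_of_injective, Finset.offDiag_card]
    rintro ⟨i, j⟩ ⟨i', j'⟩ h
    simp at h
    grind
  rw [h2, h3, ← Finset.card_union_of_disjoint, ← Finset.card_union_of_disjoint]
  · congr 1
    ext ⟨⟨i, j⟩, k, l⟩
    simp only [adjPairs, rowPairs, Finset.mem_filter, Finset.mem_univ, true_and,
      Finset.mem_union, Finset.mem_image, Finset.mem_offDiag, Prod.exists, Prod.mk.injEq,
      Finset.mem_inter, Prod.swap_prod_mk]
    simp only [IsV, Adj4]
    constructor
    · rintro ⟨h1, h2, h | h | h⟩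
      · left; left; exact ⟨h1, h2, h⟩
      · left; right; refine ⟨j, i, l, k, ?_⟩; grind
      · right; refine ⟨i, k, ?_⟩; grind
    · rintro ((h | ⟨a, b, c, d, h⟩) | ⟨a, b, h⟩)
      · grind
      · grind
      · grind
  · rw [Finset.disjoint_left]
    rintro ⟨⟨i, j⟩, k, l⟩ h h'
    simp only [adjPairs, rowPairs, Finset.mem_filter, Finset.mem_univ, true_and,
      Finset.mem_union, Finset.mem_image, Finset.mem_offDiag, Prod.exists, Prod.mk.injEq,
      Finset.mem_inter, Prod.swap_prod_mk] at h h'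
    obtain ⟨a, b, h'⟩ := h'
    rcases h with h | ⟨_, _, _, _, h⟩ <;> grind
  · rw [Finset.disjoint_left]
    rintro ⟨⟨i, j⟩, k, l⟩ h h'
    simp only [adjPairs, rowPairs, Finset.mem_filter, Finset.mem_univ, true_and,
      Finset.mem_union, Finset.mem_image, Finset.mem_offDiag, Prod.exists, Prod.mk.injEq,
      Finset.mem_inter, Prod.swap_prod_mk] at h h'
    obtain ⟨a, b, c, d, h'⟩ := h'
    grind

lemma adj4_symm {i j k l : Fin r} (h : Adj4 i j k l) : Adj4 k l i j := by
  unfold Adj4 at *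
  grind

lemma segment_ends {P : Set (Fin r → ℝ)} {u v u' : Fin r → ℝ} (hu : u ∈ P) (hv : v ∈ P)
    (hu' : u' ∈ Set.extremePoints ℝ P) (h : u' ∈ segment ℝ u v) : u' = u ∨ u' = v := by
  rcases (mem_extremePoints_iff_forall_segment.1 hu').2 u hu v hv h with h | h
  · exact Or.inl h.symm
  · exact Or.inr h.symm

/-- the segment of an ordered pair of vertices -/
noncomputable def segOf (p : (Fin r × Fin r) × (Fin r × Fin r)) : Set (Fin r → ℝ) :=
  segment ℝ (eVec r p.1.1 + eVec r p.1.2) (eVec r p.2.1 + eVec r p.2.2)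

open Classical in
lemma two_mul_numEdges (F F' : Finset (Fin r)) :
    2 * numEdgesOf (simpl F + simpl F') = (adjPairs F F').card := by
  have hs : {s : Set (Fin r → ℝ) | ∃ u v, IsEdgeOf (simpl F + simpl F') u v ∧
      s = segment ℝ u v} = (((adjPairs F F').image segOf : Finset _) : Set (Set (Fin r → ℝ))) := by
    ext s
    simp only [Set.mem_ofPred_eq, Finset.coe_image, Set.mem_image, Finset.mem_coe]
    constructor
    · rintro ⟨u, v, h, rfl⟩
      obtain ⟨i, hi, j, hj, rfl⟩ := extreme_form h.2.1
      obtain ⟨k, hk, l, hl, rfl⟩ := extreme_form h.2.2.1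
      have h1 := (extreme_iff hi hj).1 h.2.1
      have h2 := (extreme_iff hk hl).1 h.2.2.1
      refine ⟨((i, j), (k, l)), ?_, rfl⟩
      simp only [adjPairs, Finset.mem_filter, Finset.mem_univ, true_and]
      exact ⟨h1, h2, (edge_iff h1 h2).1 h⟩
    · rintro ⟨⟨⟨i, j⟩, k, l⟩, h, rfl⟩
      simp only [adjPairs, Finset.mem_filter, Finset.mem_univ, true_and] at h
      exact ⟨_, _, (edge_iff h.1 h.2.1).2 h.2.2, rfl⟩
  rw [numEdgesOf, hs, Set.ncard_coe_finset,
    Finset.card_eq_sum_card_fiberwise (f := segOf) (t := (adjPairs F F').image segOf)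
      (fun x hx => Finset.mem_coe.2 (Finset.mem_image_of_mem _ hx)),
    Finset.sum_const_nat (m := 2), mul_comm]
  intro s hs
  obtain ⟨⟨⟨i, j⟩, k, l⟩, h, rfl⟩ := Finset.mem_image.1 hs
  have hmem := h
  simp only [adjPairs, Finset.mem_filter, Finset.mem_univ, true_and] at h
  obtain ⟨h1, h2, h3⟩ := h
  have hE := (edge_iff h1 h2).2 h3
  have hne : (i, j) ≠ (k, l) := by
    intro he
    simp only [Prod.mk.injEq] at he
    obtain ⟨rfl, rfl⟩ := he
    exact hE.1 rfl
  have : ((adjPairs F F').filter fun p => segOf p = segOf ((i, j), (k, l))) =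
      {((i, j), (k, l)), ((k, l), (i, j))} := by
    ext ⟨⟨i', j'⟩, k', l'⟩
    simp only [Finset.mem_filter, Finset.mem_insert, Finset.mem_singleton]
    constructor
    · rintro ⟨h', hseg⟩
      simp only [adjPairs, Finset.mem_filter, Finset.mem_univ, true_and] at h'
      obtain ⟨h1', h2', h3'⟩ := h'
      have hE' := (edge_iff h1' h2').2 h3'
      have m1 : eVec r i' + eVec r j' ∈ segOf ((i, j), (k, l)) := by
        rw [← hseg]; exact left_mem_segment ℝ _ _
      have m2 : eVec r k' + eVec r l' ∈ segOf ((i, j), (k, l)) := by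
        rw [← hseg]; exact right_mem_segment ℝ _ _
      have e1 := segment_ends hE.2.1.1 hE.2.2.1.1 hE'.2.1 m1
      have e2 := segment_ends hE.2.1.1 hE.2.2.1.1 hE'.2.2.1 m2
      have hne' := hE'.1
      rcases e1 with e1 | e1 <;> rcases e2 with e2 | e2
      · exact absurd (e1.trans e2.symm) hne'
      · obtain ⟨rfl, rfl⟩ := vert_inj h1' h1 e1
        obtain ⟨rfl, rfl⟩ := vert_inj h2' h2 e2
        exact Or.inl rfl
      · obtain ⟨rfl, rfl⟩ := vert_inj h1' h2 e1
        obtain ⟨rfl, rfl⟩ := vert_inj h2' h1 e2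
        exact Or.inr rfl
      · exact absurd (e1.trans e2.symm) hne'
    · rintro (h | h)
      · rw [h]; exact ⟨hmem, rfl⟩
      · rw [h]
        refine ⟨?_, segment_symm ℝ _ _⟩
        simp only [adjPairs, Finset.mem_filter, Finset.mem_univ, true_and]
        exact ⟨h2, h1, adj4_symm h3⟩
  rw [this, Finset.card_pair]
  intro he
  exact hne (Prod.mk.inj he).1

end Helpers


/-- The number of edges of `P = Δ_F + Δ_{F'}` is
`(1/2)·[|F∖F'|·|F'∖F|·(|F|+|F'|−2) + |F∩F'|·(|F∪F'|−1)·(|F∖F'|+|F'∖F|+1)]`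
(stated multiplied through by 2). -/
theorem card_edges_sum_of_two {r : ℕ} (F F' : Finset (Fin r))
    (hF : F.Nonempty) (hF' : F'.Nonempty) :
    2 * numEdgesOf (simpl F + simpl F') =
      (F \ F').card * (F' \ F).card * (F.card + F'.card - 2) +
      (F ∩ F').card * ((F ∪ F').card - 1) * ((F \ F').card + (F' \ F).card + 1) := by
  rw [two_mul_numEdges, card_adjPairs, card_rowPairs, card_rowPairs, Finset.inter_comm F' F]
  have e1 : F.card = (F \ F').card + (F ∩ F').card := by
    rw [Finset.card_sdiff_add_card_inter]
  have e2 : F'.card = (F' \ F).card + (F ∩ F').card := by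
    rw [Finset.inter_comm, Finset.card_sdiff_add_card_inter]
  have e3 : (F ∪ F').card = (F \ F').card + (F' \ F).card + (F ∩ F').card := by
    have := Finset.card_union_add_card_inter F F'
    omega
  have p1 := hF.card_pos
  have p2 := hF'.card_pos
  rw [e3]
  rw [e1] at p1 ⊢
  rw [e2] at p2 ⊢
  generalize (F \ F').card = a at *
  generalize (F' \ F).card = b at *
  generalize (F ∩ F').card = c at *
  have q : ∀ n : ℕ, n ≤ n * n := fun n => Nat.le_mul_self n
  have p3 : 2 ≤ a + c + (b + c) := by omega
  have p4 : 1 ≤ a + b + c := by omega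
  zify [q, p3, p4]
  ring
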